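/- Theorem 4.2 (generalized Gauss formula): Let Γ ⊂ H be μ-measurable such that I_Γ ∈ BV(H,H₁) and I_Γ satisfies the ray Hamza condition in direction e_k for every k ∈ ℕ. Let m be a finite positive Borel measure on H and σ : H → H₁* a Borel map with ‖σ(z)‖_{H₁*} = 1 for m-a.e. z, such that ∫_Γ D*G(z) μ(dz) = ∫_H ⟨G(z), σ(z)⟩ m(dz) for all G ∈ (C_b¹)_{D(A)∩H₁}. Then m is carried by the topological boundary ∂Γ of Γ, i.e. m(H ∖ ∂Γ) = 0; in particular ∫_Γ D*G(z) μ(dz) = ∫_{∂Γ} ⟨G(z), σ(z)⟩ m(dz) for all G ∈ (C_b¹)_{D(A)∩H₁}. -/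

import Mathlib

open MeasureTheory Filter
open scoped RealInnerProductSpace ENNReal NNReal BigOperators

noncomputable section

variable {H : Type*} [NormedAddCommGroup H] [InnerProductSpace ℝ H]

/-- `v ∈ C_b¹(H)` with gradient `Dv`: `v` is bounded, everywhere Fréchet differentiable with
derivative represented by the gradient `Dv`, and `Dv` is continuous and bounded. -/
def IsCb1 (v : H → ℝ) (Dv : H → H) : Prop :=
  (∀ x : H, HasFDerivAt v (innerSL ℝ (Dv x)) x) ∧ Continuous Dv ∧
    (∃ C, ∀ x, |v x| ≤ C) ∧ ∃ C, ∀ x, ‖Dv x‖ ≤ C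

/-- The operator `A` determined by `A e_j = α_j e_j`. -/
def Aop (e : ℕ → H) (α : ℕ → ℝ) (x : H) : H := ∑' j, (α j * ⟪x, e j⟫) • e j

/-- Membership in the domain `D(A)`. -/
def memDA (e : ℕ → H) (α : ℕ → ℝ) (x : H) : Prop :=
  Summable fun j => α j ^ 2 * ⟪x, e j⟫ ^ 2

/-- The covariance operator `Q = (1/2) A⁻¹`, i.e. `Q e_j = (2 α_j)⁻¹ e_j`. -/
def Qop (e : ℕ → H) (α : ℕ → ℝ) (x : H) : H := ∑' j, ((2 * α j)⁻¹ * ⟪x, e j⟫) • e j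

/-- `Q^{1/2}`, i.e. `Q^{1/2} e_j = (2 α_j)^{-1/2} e_j`. -/
def Qhalf (e : ℕ → H) (α : ℕ → ℝ) (x : H) : H :=
  ∑' j, ((Real.sqrt (2 * α j))⁻¹ * ⟪x, e j⟫) • e j

/-- `D*G` for `G(z) = ∑_{i} g_i(z) l^i` (`Dg i` being the gradient of `g i`):
`D*G(z) = ∑ i (−⟨l^i, Dg_i(z)⟩ + 2 g_i(z) ⟨A l^i, z⟩)`. -/
def Dstar (e : ℕ → H) (α : ℕ → ℝ) {m : ℕ} (g : Fin m → H → ℝ) (Dg : Fin m → H → H)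
    (l : Fin m → H) (z : H) : ℝ :=
  ∑ i, (-⟪l i, Dg i z⟫ + 2 * g i z * ⟪Aop e α (l i), z⟫)

/-- Membership in `H₁ = {x : ∑_j c_j² ⟨x,e_j⟩² < ∞}`. -/
def memH1 (c : ℕ → ℝ) (e : ℕ → H) (x : H) : Prop :=
  Summable fun j => c j ^ 2 * ⟪x, e j⟫ ^ 2

/-- The squared `H₁`-norm `∑_j c_j² ⟨x,e_j⟩²`. -/
def normH1sq (c : ℕ → ℝ) (e : ℕ → H) (x : H) : ℝ := ∑' j, c j ^ 2 * ⟪x, e j⟫ ^ 2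

/-- The `H₁`-inner product `∑_j c_j² ⟨x,e_j⟩⟨y,e_j⟩`. -/
def innerH1 (c : ℕ → ℝ) (e : ℕ → H) (x y : H) : ℝ :=
  ∑' j, c j ^ 2 * (⟪x, e j⟫ * ⟪y, e j⟫)

/-- `A_{1/2}(x) = ∫₀ˣ (log(1+s))^{1/2} ds`. -/
def A12 (x : ℝ) : ℝ := ∫ s in (0:ℝ)..x, Real.sqrt (Real.log (1 + s))

/-- `ψ(y) = ∫₀ʸ (exp(t²) − 1) dt`. -/
def psiOrlicz (y : ℝ) : ℝ := ∫ t in (0:ℝ)..y, (Real.exp (t ^ 2) - 1)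

variable [MeasurableSpace H]

/-- The set whose infimum is the Luxemburg norm of `f` for the Young function `Φ`. -/
def LuxSet (Φ : ℝ → ℝ) (μ : Measure H) (f : H → ℝ) : Set ℝ :=
  {a | 0 < a ∧ ∫ x, Φ (|f x| / a) ∂μ ≤ 1}

/-- The Luxemburg norm. -/
def LuxNorm (Φ : ℝ → ℝ) (μ : Measure H) (f : H → ℝ) : ℝ := sInf (LuxSet Φ μ f)

/-- The set of numbers `∫_H D*G ρ dμ`, where `G` ranges over all
`G ∈ (C_b¹)_{D(A)∩H₁}` with `‖G(z)‖_{H₁} ≤ 1` for all `z`; its supremum is `V(ρ)`. -/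
def BVset (c : ℕ → ℝ) (e : ℕ → H) (α : ℕ → ℝ) (μ : Measure H) (ρ : H → ℝ) : Set ℝ :=
  {r | ∃ (m : ℕ) (g : Fin m → H → ℝ) (Dg : Fin m → H → H) (l : Fin m → H),
    (∀ i, IsCb1 (g i) (Dg i)) ∧ (∀ i, memDA e α (l i)) ∧ (∀ i, memH1 c e (l i)) ∧
    (∀ z, memH1 c e (∑ i, g i z • l i) ∧ normH1sq c e (∑ i, g i z • l i) ≤ 1) ∧
    r = ∫ z, Dstar e α g Dg l z * ρ z ∂μ}

/-- The analogous set for `H₁ = H` (weights `c_j ≡ 1`), where the constraint is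
`|G(z)| ≤ 1` in `H`; its supremum is `V(ρ)` for `BV(H,H)`. -/
def BVsetH (e : ℕ → H) (α : ℕ → ℝ) (μ : Measure H) (ρ : H → ℝ) : Set ℝ :=
  {r | ∃ (m : ℕ) (g : Fin m → H → ℝ) (Dg : Fin m → H → H) (l : Fin m → H),
    (∀ i, IsCb1 (g i) (Dg i)) ∧ (∀ i, memDA e α (l i)) ∧
    (∀ z, ‖∑ i, g i z • l i‖ ≤ 1) ∧
    r = ∫ z, Dstar e α g Dg l z * ρ z ∂μ}

/-- The set `R(h) = {s : ∫_{s-ε}^{s+ε} 1/h(r) dr < ∞ for some ε > 0}`. -/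
def HamzaR (h : ℝ → ℝ) : Set ℝ :=
  {s | ∃ ε > 0, ∫⁻ r in Set.Ioo (s - ε) (s + ε), (ENNReal.ofReal (h r))⁻¹ < ⊤}

/-- `h` has the Hamza property: `h = 0` Lebesgue-a.e. on `ℝ ∖ R(h)`. -/
def HasHamza (h : ℝ → ℝ) : Prop :=
  ∀ᵐ s ∂(MeasureTheory.volume.restrict (HamzaR h)ᶜ), h s = 0

/-- `ρ` satisfies the ray Hamza condition in direction `l`. -/
def RayHamza {H : Type*} [NormedAddCommGroup H] [InnerProductSpace ℝ H]
    [MeasurableSpace H] (μ : Measure H) (ρ : H → ℝ) (l : H) : Prop :=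
  ∃ ρ' : H → ℝ, Measurable ρ' ∧ ρ' =ᵐ[μ] ρ ∧ (∀ z, 0 ≤ ρ' z) ∧
    ∀ z : H, HasHamza fun s => ρ' (z + s • l)

theorem hasDerivAt_max_zero_sq (t : ℝ) :
    HasDerivAt (fun s : ℝ => max 0 s ^ 2) (2 * max 0 t) t := by
  rcases lt_trichotomy t 0 with ht | rfl | ht
  · rw [max_eq_left ht.le, mul_zero]
    refine (hasDerivAt_const t (0 : ℝ)).congr_of_eventuallyEq ?_
    filter_upwards [Iio_mem_nhds ht] with s hs
    simp [max_eq_left (le_of_lt (Set.mem_Iio.1 hs))]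
  · rw [max_self, mul_zero, hasDerivAt_iff_isLittleO_nhds_zero]
    have h : (fun s : ℝ => s ^ 2) =o[nhds 0] fun s : ℝ => s := by
      simpa using Asymptotics.isLittleO_pow_id (𝕜 := ℝ) one_lt_two
    refine Asymptotics.IsBigO.trans_isLittleO (Asymptotics.IsBigO.of_bound 1 ?_) h
    refine Eventually.of_forall fun s => ?_
    have : |max 0 s| ≤ |s| := by
      rw [abs_of_nonneg (le_max_left 0 s)]
      exact max_le (abs_nonneg s) (le_abs_self s)
    simpa using sq_le_sq.2 this
  · rw [max_eq_right ht.le]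
    have h : HasDerivAt (fun s : ℝ => s ^ 2) (2 * t) t := by simpa using hasDerivAt_pow 2 t
    refine h.congr_of_eventuallyEq ?_
    filter_upwards [Ioi_mem_nhds ht] with s hs
    simp [max_eq_right (le_of_lt (Set.mem_Ioi.1 hs))]

theorem isCb1_ball {H : Type*} [NormedAddCommGroup H] [InnerProductSpace ℝ H]
    (a : H) (r : ℝ) :
    IsCb1 (fun z => max 0 (r ^ 2 - ‖z - a‖ ^ 2) ^ 2)
      (fun z => (-4 * max 0 (r ^ 2 - ‖z - a‖ ^ 2)) • (z - a)) := by
  have hle : ∀ z, max 0 (r ^ 2 - ‖z - a‖ ^ 2) ≤ r ^ 2 := fun z =>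
    max_le (sq_nonneg r) (by nlinarith [sq_nonneg ‖z - a‖])
  have h0 : ∀ z, 0 ≤ max 0 (r ^ 2 - ‖z - a‖ ^ 2) := fun z => le_max_left _ _
  refine ⟨fun z => ?_, by fun_prop, ⟨(r ^ 2) ^ 2, fun z => ?_⟩, ⟨4 * r ^ 2 * |r|, fun z => ?_⟩⟩
  · have h := (((hasFDerivAt_id z).sub_const a).norm_sq).const_sub (r ^ 2)
    refine ((hasDerivAt_max_zero_sq _).comp_hasFDerivAt z h).congr_fderiv ?_
    ext y
    simp
    ring
  · rw [abs_of_nonneg (sq_nonneg _)]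
    exact pow_le_pow_left₀ (h0 z) (hle z) 2
  · rw [norm_smul, norm_mul, Real.norm_of_nonneg (h0 z)]
    rcases le_or_gt (r ^ 2 - ‖z - a‖ ^ 2) 0 with h | h
    · rw [max_eq_left h]
      simp only [mul_zero, zero_mul]
      positivity
    · have hz : ‖z - a‖ ≤ |r| := by
        rw [← abs_norm (z - a)]
        exact sq_le_sq.mp (by linarith)
      have : ‖(-4 : ℝ)‖ = 4 := by norm_num
      rw [this]
      gcongr
      exact hle z

theorem IsCb1.mul {H : Type*} [NormedAddCommGroup H] [InnerProductSpace ℝ H]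
    {u v : H → ℝ} {Du Dv : H → H} (hu : IsCb1 u Du) (hv : IsCb1 v Dv) :
    IsCb1 (fun z => u z * v z) (fun z => u z • Dv z + v z • Du z) := by
  obtain ⟨hu1, hu2, ⟨C, hC⟩, ⟨C', hC'⟩⟩ := hu
  obtain ⟨hv1, hv2, ⟨K, hK⟩, ⟨K', hK'⟩⟩ := hv
  have cu : Continuous u := continuous_iff_continuousAt.2 fun x => (hu1 x).continuousAt
  have cv : Continuous v := continuous_iff_continuousAt.2 fun x => (hv1 x).continuousAt
  refine ⟨fun x => ?_, by fun_prop, ⟨C * K, fun x => ?_⟩, ⟨C * K' + K * C', fun x => ?_⟩⟩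
  · refine ((hu1 x).mul (hv1 x)).congr_fderiv ?_
    simp
  · rw [abs_mul]
    exact mul_le_mul (hC x) (hK x) (abs_nonneg _) ((abs_nonneg _).trans (hC x))
  · refine (norm_add_le _ _).trans (add_le_add ?_ ?_) <;> rw [norm_smul, Real.norm_eq_abs]
    · exact mul_le_mul (hC x) (hK' x) (norm_nonneg _) ((abs_nonneg _).trans (hC x))
    · exact mul_le_mul (hK x) (hC' x) (norm_nonneg _) ((abs_nonneg _).trans (hK x))

theorem IsCb1.one_sub_exp {H : Type*} [NormedAddCommGroup H] [InnerProductSpace ℝ H]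
    {v : H → ℝ} {Dv : H → H} (hv : IsCb1 v Dv) (h0 : ∀ z, 0 ≤ v z)
    {N : ℝ} (hN : 0 ≤ N) :
    IsCb1 (fun z => 1 - Real.exp (-(N * v z))) (fun z => (N * Real.exp (-(N * v z))) • Dv z) := by
  obtain ⟨hv1, hv2, -, ⟨K', hK'⟩⟩ := hv
  have cv : Continuous v := continuous_iff_continuousAt.2 fun x => (hv1 x).continuousAt
  have he : ∀ z, Real.exp (-(N * v z)) ≤ 1 := fun z =>
    Real.exp_le_one_iff.2 (neg_nonpos.2 (mul_nonneg hN (h0 z)))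
  refine ⟨fun x => ?_, by fun_prop, ⟨1, fun x => ?_⟩, ⟨N * K', fun x => ?_⟩⟩
  · refine ((((hv1 x).const_mul N).neg).exp.const_sub 1).congr_fderiv ?_
    ext y
    simp
    ring
  · rw [abs_le]
    constructor <;> linarith [he x, Real.exp_pos (-(N * v x))]
  · rw [norm_smul, norm_mul, Real.norm_of_nonneg hN, Real.norm_of_nonneg (Real.exp_nonneg _)]
    have := mul_le_of_le_one_right hN (he x)
    exact mul_le_mul this (hK' x) (norm_nonneg _) hN

/-- The sets `{v > 0}` with `v ∈ C_b¹(H)` nonnegative. -/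
def positivitySets (H : Type*) [NormedAddCommGroup H] [InnerProductSpace ℝ H] : Set (Set H) :=
  {s | ∃ (v : H → ℝ) (Dv : H → H), IsCb1 v Dv ∧ (∀ z, 0 ≤ v z) ∧ s = {z | 0 < v z}}

theorem ball_mem_positivitySets {H : Type*} [NormedAddCommGroup H] [InnerProductSpace ℝ H]
    (a : H) {r : ℝ} (hr : 0 < r) :
    Metric.ball a r ∈ positivitySets H := by
  refine ⟨_, _, isCb1_ball a r, fun z => sq_nonneg _, ?_⟩
  ext z
  change z ∈ Metric.ball a r ↔ 0 < max 0 (r ^ 2 - ‖z - a‖ ^ 2) ^ 2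
  rw [mem_ball_iff_norm, sq_pos_iff, ← sq_lt_sq₀ (norm_nonneg _) hr.le]
  constructor
  · intro h
    exact (lt_max_of_lt_right (sub_pos.2 h)).ne'
  · intro h
    by_contra hlt
    exact h (max_eq_left (sub_nonpos.2 (not_lt.1 hlt)))

theorem inter_mem_positivitySets {H : Type*} [NormedAddCommGroup H] [InnerProductSpace ℝ H]
    {s t : Set H} (hs : s ∈ positivitySets H)
    (ht : t ∈ positivitySets H) : s ∩ t ∈ positivitySets H := by
  obtain ⟨u, Du, hu, hu0, rfl⟩ := hs
  obtain ⟨v, Dv, hv, hv0, rfl⟩ := ht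
  refine ⟨_, _, hu.mul hv, fun z => mul_nonneg (hu0 z) (hv0 z), ?_⟩
  ext z
  change (0 < u z ∧ 0 < v z) ↔ 0 < u z * v z
  exact ⟨fun h => mul_pos h.1 h.2, fun h =>
    ⟨(hu0 z).lt_of_ne (fun h' => by simp [← h'] at h),
      (hv0 z).lt_of_ne (fun h' => by simp [← h'] at h)⟩⟩

theorem isOpen_of_mem_positivitySets {H : Type*} [NormedAddCommGroup H] [InnerProductSpace ℝ H]
    {s : Set H} (hs : s ∈ positivitySets H) : IsOpen s := by
  obtain ⟨u, Du, hu, -, rfl⟩ := hs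
  have cu : Continuous u := continuous_iff_continuousAt.2 fun x => (hu.1 x).continuousAt
  exact isOpen_lt continuous_const cu

theorem isTopologicalBasis_positivitySets {H : Type*} [NormedAddCommGroup H] [InnerProductSpace ℝ H] :
    TopologicalSpace.IsTopologicalBasis (positivitySets H) := by
  refine TopologicalSpace.isTopologicalBasis_of_isOpen_of_nhds
    (fun _ => isOpen_of_mem_positivitySets) fun a u ha hu => ?_
  obtain ⟨r, hr, hru⟩ := Metric.isOpen_iff.1 hu a ha
  exact ⟨_, ball_mem_positivitySets a hr, Metric.mem_ball_self hr, hru⟩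

/-- A nonnegative function of class `C_b¹` has vanishing gradient at each of its zeros. -/
theorem IsCb1.gradient_eq_zero {H : Type*} [NormedAddCommGroup H] [InnerProductSpace ℝ H]
    {v : H → ℝ} {Dv : H → H} (hv : IsCb1 v Dv) (h0 : ∀ z, 0 ≤ v z)
    {z : H} (hz : v z = 0) : Dv z = 0 := by
  have hmin : IsLocalMin v z := Eventually.of_forall fun y => hz ▸ h0 y
  have := hmin.hasFDerivAt_eq_zero (hv.1 z)
  have h2 : innerSL ℝ (Dv z) (Dv z) = 0 := by rw [this]; rfl
  simpa using h2

/-- If an integrable `f` integrates to zero against every nonnegative `v ∈ C_b¹(H)` vanishing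
outside a basic set `s`, then `f = 0` almost everywhere on `s`. -/
theorem ae_restrict_eq_zero_of_integral_mul_eq_zero [SecondCountableTopology H] [BorelSpace H]
    {m : Measure H} [IsFiniteMeasure m] {f : H → ℝ} (hf : Integrable f m) {s : Set H}
    (hs : s ∈ positivitySets H)
    (h : ∀ (v : H → ℝ) (Dv : H → H), IsCb1 v Dv → (∀ z, 0 ≤ v z) → (∀ z ∉ s, v z = 0) →
      ∫ z, v z * f z ∂m = 0) :
    f =ᵐ[m.restrict s] 0 := by
  have hbasic : ∀ t ∈ positivitySets H, t ⊆ s → ∫ z in t, f z ∂m = 0 := by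
    intro t ht hts
    have htm := (isOpen_of_mem_positivitySets ht).measurableSet
    obtain ⟨v, Dv, hv, hv0, rfl⟩ := ht
    have cv : Continuous v := continuous_iff_continuousAt.2 fun x => (hv.1 x).continuousAt
    have hlim : Tendsto (fun N : ℕ => ∫ z, (1 - Real.exp (-((N : ℝ) * v z))) * f z ∂m) atTop
        (nhds (∫ z, {z | 0 < v z}.indicator f z ∂m)) := by
      refine tendsto_integral_of_dominated_convergence (fun z => ‖f z‖) (fun N => ?_) hf.norm
        (fun N => ae_of_all _ fun z => ?_) (ae_of_all _ fun z => ?_)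
      · exact (Continuous.aestronglyMeasurable (by fun_prop)).mul hf.1
      · rw [norm_mul]
        refine mul_le_of_le_one_left (norm_nonneg _) ?_
        have : Real.exp (-((N : ℝ) * v z)) ≤ 1 :=
          Real.exp_le_one_iff.2 (neg_nonpos.2 (mul_nonneg N.cast_nonneg (hv0 z)))
        rw [Real.norm_eq_abs, abs_le]
        constructor <;> linarith [Real.exp_pos (-((N : ℝ) * v z))]
      · by_cases hz : 0 < v z
        · rw [Set.indicator_of_mem (show z ∈ {z | 0 < v z} from hz)]
          have h1 : Tendsto (fun N : ℕ => Real.exp (-((N : ℝ) * v z))) atTop (nhds 0) :=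
            Real.tendsto_exp_neg_atTop_nhds_zero.comp
              (tendsto_natCast_atTop_atTop.atTop_mul_const hz)
          simpa using (h1.const_sub 1).mul_const (f z)
        · rw [Set.indicator_of_notMem (show z ∉ {z | 0 < v z} from hz)]
          have : v z = 0 := le_antisymm (not_lt.1 hz) (hv0 z)
          simp [this]
    rw [← integral_indicator htm]
    refine tendsto_nhds_unique hlim ?_
    refine tendsto_const_nhds.congr fun N => (h _ _ (hv.one_sub_exp hv0 N.cast_nonneg)
      (fun z => ?_) fun z hz => ?_).symm
    · have : Real.exp (-((N : ℝ) * v z)) ≤ 1 :=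
        Real.exp_le_one_iff.2 (neg_nonpos.2 (mul_nonneg N.cast_nonneg (hv0 z)))
      linarith
    · have : v z = 0 := le_antisymm (not_lt.1 fun h' => hz (hts h')) (hv0 z)
      simp [this]
  refine (hf.restrict (s := s)).ae_eq_zero_of_forall_setIntegral_eq_zero fun t ht _ => ?_
  have hsm := (isOpen_of_mem_positivitySets hs).measurableSet
  induction t, ht using MeasurableSpace.induction_on_inter
    ((BorelSpace.measurable_eq (α := H)).trans
      isTopologicalBasis_positivitySets.borel_eq_generateFrom)
    (fun _ hu _ hv _ => inter_mem_positivitySets hu hv) with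
  | empty => simp
  | basic t ht =>
    rw [Measure.restrict_restrict (isOpen_of_mem_positivitySets ht).measurableSet]
    exact hbasic _ (inter_mem_positivitySets ht hs) Set.inter_subset_right
  | compl t ht iht =>
    have h1 := integral_add_compl ht (hf.restrict (s := s))
    rw [iht (measure_lt_top _ _), zero_add] at h1
    rw [h1]
    exact hbasic s hs subset_rfl
  | iUnion t hd ht iht =>
    rw [integral_iUnion ht hd (hf.restrict (s := s)).integrableOn]
    simp [fun i => iht i (measure_lt_top _ _)]

/-- Gaussian integration by parts on the real line. -/
theorem integral_gaussianReal_by_parts {v : ℝ≥0} (hv : v ≠ 0) {f f' : ℝ → ℝ}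
    (hf : ∀ s, HasDerivAt f (f' s) s) (hf' : Continuous f')
    (hb : ∃ C, ∀ s, |f s| ≤ C) (hb' : ∃ C, ∀ s, |f' s| ≤ C) :
    ∫ s, (-f' s + f s * (s / v)) ∂(ProbabilityTheory.gaussianReal 0 v) = 0 := by
  obtain ⟨C, hC⟩ := hb
  obtain ⟨C', hC'⟩ := hb'
  have cf : Continuous f := continuous_iff_continuousAt.2 fun x => (hf x).continuousAt
  have hv0 : (0 : ℝ) < v := by exact_mod_cast pos_iff_ne_zero.2 hv
  set p := ProbabilityTheory.gaussianPDFReal 0 v with hp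
  have hpint : Integrable p := ProbabilityTheory.integrable_gaussianPDFReal 0 v
  have hpd : ∀ s, HasDerivAt p (p s * (-(s / v))) s := by
    intro s
    have h1 : HasDerivAt (fun x : ℝ => -(x - 0) ^ 2 / (2 * (v : ℝ))) (-(s / v)) s := by
      have := (((hasDerivAt_id s).sub_const 0).pow 2).neg.div_const (2 * (v : ℝ))
      refine this.congr_deriv ?_
      simp
      field_simp
    have h2 := h1.exp.const_mul (√(2 * Real.pi * v))⁻¹
    refine h2.congr_deriv ?_
    simp only [hp, ProbabilityTheory.gaussianPDFReal]
    ring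
  have hspint : Integrable fun s => p s * (s / v) := by
    have := (integrable_mul_exp_neg_mul_sq (b := (2 * (v : ℝ))⁻¹) (by positivity)).const_mul
      ((√(2 * Real.pi * v))⁻¹ * (v : ℝ)⁻¹)
    refine this.congr (ae_of_all _ fun s => ?_)
    simp only [hp, ProbabilityTheory.gaussianPDFReal]
    have : -(2 * (v : ℝ))⁻¹ * s ^ 2 = -(s - 0) ^ 2 / (2 * v) := by field_simp; ring
    rw [this]
    ring
  have h1 : Integrable fun s => f s * p s :=
    hpint.bdd_mul cf.aestronglyMeasurable (ae_of_all _ hC)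
  have h2 : Integrable fun s => f' s * p s + f s * (p s * (-(s / v))) := by
    refine (hpint.bdd_mul hf'.aestronglyMeasurable (ae_of_all _ hC')).add ?_
    refine Integrable.bdd_mul ?_ cf.aestronglyMeasurable (ae_of_all _ hC)
    simpa using hspint.neg
  have h3 := integral_eq_zero_of_hasDerivAt_of_integrable
    (fun s => (hf s).mul (hpd s)) h2 h1
  rw [ProbabilityTheory.integral_gaussianReal_eq_integral_smul hv, ← neg_eq_zero, ← integral_neg]
  refine Eq.trans ?_ h3
  refine integral_congr_ae (ae_of_all _ fun s => ?_)
  simp only [smul_eq_mul, ← hp]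
  ring

theorem hasSum_inner_Qop {H : Type*} [NormedAddCommGroup H] [InnerProductSpace ℝ H]
    [CompleteSpace H] {e : ℕ → H} (hON : Orthonormal ℝ e) {α : ℕ → ℝ}
    (hα : ∀ j, 0 < α j) (hαsum : Summable fun j => (α j)⁻¹) (h : H) :
    HasSum (fun j => (2 * α j)⁻¹ * ⟪h, e j⟫ ^ 2) ⟪Qop e α h, h⟫ := by
  have hs : Summable fun j => ((2 * α j)⁻¹ * ⟪h, e j⟫) • e j := by
    refine Summable.of_norm_bounded (g := fun j => (α j)⁻¹ * ((2 : ℝ)⁻¹ * ‖h‖))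
      (hαsum.mul_right _) fun j => ?_
    have h1 : |⟪h, e j⟫| ≤ ‖h‖ := by
      simpa [hON.norm_eq_one j] using abs_real_inner_le_norm h (e j)
    have h2 := hα j
    rw [norm_smul, hON.norm_eq_one j, mul_one, norm_mul, Real.norm_eq_abs, Real.norm_eq_abs,
      abs_of_pos (by positivity), mul_inv]
    calc _ ≤ 2⁻¹ * (α j)⁻¹ * ‖h‖ := by gcongr
      _ = _ := by ring
  have := hs.hasSum.mapL (innerSL ℝ h)
  rw [Qop, real_inner_comm]
  refine this.congr_fun fun j => ?_
  rw [innerSL_apply_apply, real_inner_smul_right]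
  ring

theorem charFun_eq_exp_Qop [SecondCountableTopology H] [BorelSpace H]
    {e : ℕ → H} {α : ℕ → ℝ} {μ : Measure H}
    (hGauss : ∀ h : H, μ.map (fun x => ⟪x, h⟫)
      = ProbabilityTheory.gaussianReal 0 (Real.toNNReal ⟪Qop e α h, h⟫)) (h : H)
    (hnn : 0 ≤ ⟪Qop e α h, h⟫) :
    charFun μ h = Complex.exp (-(⟪Qop e α h, h⟫ : ℂ) / 2) := by
  have h1 : charFun μ h = charFun (μ.map fun x => ⟪x, h⟫) 1 := by
    rw [charFun_apply, charFun_apply_real, integral_map (by fun_prop) (by fun_prop)]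
    simp
  rw [h1, hGauss h, ProbabilityTheory.charFun_gaussianReal]
  congr 1
  simp [Real.coe_toNNReal _ hnn]
  ring

section Gaussian

variable [CompleteSpace H] [SecondCountableTopology H] [BorelSpace H]
  {e : ℕ → H} {α : ℕ → ℝ} {μ : Measure H} [IsProbabilityMeasure μ]

/-- The `k`-th coordinate can be resampled independently without changing the law `μ`. -/
theorem map_resample_coordinate (hON : Orthonormal ℝ e)
    (hα : ∀ j, 0 < α j) (hαsum : Summable fun j => (α j)⁻¹)
    (hGauss : ∀ h : H, μ.map (fun x => ⟪x, h⟫)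
      = ProbabilityTheory.gaussianReal 0 (Real.toNNReal ⟪Qop e α h, h⟫)) (k : ℕ) :
    ((ProbabilityTheory.gaussianReal 0 (Real.toNNReal (2 * α k)⁻¹)).prod μ).map
      (fun p : ℝ × H => p.2 + (p.1 - ⟪p.2, e k⟫) • e k) = μ := by
  have hmeas : Continuous fun p : ℝ × H => p.2 + (p.1 - ⟪p.2, e k⟫) • e k := by fun_prop
  have := Measure.isProbabilityMeasure_map
    (μ := (ProbabilityTheory.gaussianReal 0 (Real.toNNReal (2 * α k)⁻¹)).prod μ)
    hmeas.measurable.aemeasurable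
  refine Measure.ext_of_charFun (funext fun h => ?_)
  set h' := h - ⟪h, e k⟫ • e k with hh'
  have hq := hasSum_inner_Qop hON hα hαsum h
  have hq' := hasSum_inner_Qop hON hα hαsum h'
  have hnn : ∀ x : H, 0 ≤ ⟪Qop e α x, x⟫ := fun x =>
    (hasSum_inner_Qop hON hα hαsum x).nonneg fun j => by have := hα j; positivity
  have hsplit : ⟪Qop e α h, h⟫ = ⟪Qop e α h', h'⟫ + (2 * α k)⁻¹ * ⟪h, e k⟫ ^ 2 := by
    refine hq.unique ?_
    convert hq'.add (hasSum_ite_eq k ((2 * α k)⁻¹ * ⟪h, e k⟫ ^ 2)) using 2 with j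
    rw [hh', inner_sub_left, real_inner_smul_left]
    split_ifs with hj
    · subst hj
      rw [real_inner_self_eq_norm_sq, hON.norm_eq_one]
      ring
    · rw [hON.inner_eq_zero (Ne.symm hj)]
      ring
  rw [charFun_apply, integral_map hmeas.measurable.aemeasurable (by fun_prop)]
  have hfac : ∀ p : ℝ × H,
      Complex.exp (⟪p.2 + (p.1 - ⟪p.2, e k⟫) • e k, h⟫ * Complex.I)
        = Complex.exp ((⟪h, e k⟫ : ℝ) * p.1 * Complex.I) * Complex.exp (⟪p.2, h'⟫ * Complex.I) := by
    intro p
    rw [← Complex.exp_add, hh', inner_add_left, inner_sub_right, real_inner_smul_left,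
      real_inner_smul_right, real_inner_comm h (e k)]
    congr 1
    push_cast
    ring
  simp_rw [hfac]
  rw [integral_prod_mul (fun s : ℝ => Complex.exp ((⟪h, e k⟫ : ℝ) * s * Complex.I))
    (fun z : H => Complex.exp (⟪z, h'⟫ * Complex.I)), ← charFun_apply, ← charFun_apply_real,
    ProbabilityTheory.charFun_gaussianReal, charFun_eq_exp_Qop hGauss h' (hnn h'),
    charFun_eq_exp_Qop hGauss h (hnn h), ← Complex.exp_add, hsplit,
    Real.coe_toNNReal _ (by have := hα k; positivity)]
  congr 1
  push_cast
  ring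

theorem IsCb1.integral_by_parts (hON : Orthonormal ℝ e)
    (hα : ∀ j, 0 < α j) (hαsum : Summable fun j => (α j)⁻¹)
    (hGauss : ∀ h : H, μ.map (fun x => ⟪x, h⟫)
      = ProbabilityTheory.gaussianReal 0 (Real.toNNReal ⟪Qop e α h, h⟫)) (k : ℕ)
    {g : H → ℝ} {Dg : H → H} (hg : IsCb1 g Dg) :
    ∫ z, (-⟪e k, Dg z⟫ + 2 * g z * (α k * ⟪e k, z⟫)) ∂μ = 0 := by
  obtain ⟨hg1, hg2, ⟨C, hC⟩, ⟨C', hC'⟩⟩ := hg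
  have cg : Continuous g := continuous_iff_continuousAt.2 fun x => (hg1 x).continuousAt
  have hcoord : Integrable (fun z => ⟪z, e k⟫) μ := by
    have h1 : Integrable (fun x : ℝ => x) (μ.map fun x => ⟪x, e k⟫) := by
      rw [hGauss]
      exact (ProbabilityTheory.memLp_id_gaussianReal 1).integrable le_rfl
    exact h1.comp_measurable (by fun_prop)
  have hbd : ∀ z, |⟪e k, Dg z⟫| ≤ C' := fun z => by
    simpa [hON.norm_eq_one k] using
      (abs_real_inner_le_norm (e k) (Dg z)).trans (by simpa [hON.norm_eq_one k] using hC' z)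
  have hint : Integrable (fun z => -⟪e k, Dg z⟫ + 2 * g z * (α k * ⟪e k, z⟫)) μ := by
    refine Integrable.add ?_ ?_
    · exact Integrable.of_bound (by fun_prop) C' (ae_of_all _ fun z => by simpa using hbd z)
    · refine Integrable.bdd_mul (c := 2 * C) ?_ (by fun_prop) (ae_of_all _ fun z => ?_)
      · simpa only [real_inner_comm] using hcoord.const_mul (α k)
      · rw [norm_mul, Real.norm_eq_abs, Real.norm_eq_abs, abs_two]
        exact mul_le_mul_of_nonneg_left (hC z) zero_le_two
  have hlaw := map_resample_coordinate hON hα hαsum hGauss k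
  have hmeas : Continuous fun p : ℝ × H => p.2 + (p.1 - ⟪p.2, e k⟫) • e k := by fun_prop
  have hk := hα k
  have hv : Real.toNNReal (2 * α k)⁻¹ ≠ 0 := by
    simpa using hk
  rw [← hlaw] at hint
  rw [← hlaw, integral_map hmeas.measurable.aemeasurable hint.1]
  refine (integral_prod_symm _ (hint.comp_measurable hmeas.measurable)).trans
    (integral_eq_zero_of_ae (ae_of_all _ fun z => ?_))
  have hline : ∀ s : ℝ, HasDerivAt (fun s : ℝ => z + (s - ⟪z, e k⟫) • e k) (e k) s := fun s => by
    simpa using (((hasDerivAt_id s).sub_const ⟪z, e k⟫).smul_const (e k)).const_add z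
  have key := integral_gaussianReal_by_parts hv
    (f := fun s => g (z + (s - ⟪z, e k⟫) • e k))
    (f' := fun s => ⟪e k, Dg (z + (s - ⟪z, e k⟫) • e k)⟫)
    (fun s => by
      refine ((hg1 (z + (s - ⟪z, e k⟫) • e k)).comp_hasDerivAt s (hline s)).congr_deriv ?_
      simp [real_inner_comm])
    (by fun_prop) ⟨C, fun s => hC _⟩ ⟨C', fun s => hbd _⟩
  refine Eq.trans ?_ key
  refine integral_congr_ae (ae_of_all _ fun s => ?_)
  simp only [Function.comp_apply, inner_add_right, inner_smul_right, real_inner_self_eq_norm_sq, hON.norm_eq_one]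
  rw [Real.coe_toNNReal _ (by positivity), real_inner_comm z (e k)]
  field_simp
  ring

end Gaussian

theorem Aop_basis {H : Type*} [NormedAddCommGroup H] [InnerProductSpace ℝ H]
    {e : ℕ → H} (hON : Orthonormal ℝ e) (α : ℕ → ℝ) (k : ℕ) :
    Aop e α (e k) = α k • e k := by
  rw [Aop, tsum_eq_single k]
  · rw [real_inner_self_eq_norm_sq, hON.norm_eq_one]
    simp
  · intro j hj
    rw [hON.inner_eq_zero hj.symm]
    simp

theorem summable_sq_mul_inner_basis {H : Type*} [NormedAddCommGroup H] [InnerProductSpace ℝ H]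
    {e : ℕ → H} (hON : Orthonormal ℝ e) (w : ℕ → ℝ) (k : ℕ) :
    Summable fun j => w j ^ 2 * ⟪e k, e j⟫ ^ 2 := by
  refine summable_of_ne_finset_zero (s := {k}) fun j hj => ?_
  rw [hON.inner_eq_zero (by simpa [eq_comm] using hj)]
  simp

/-- Theorem 4.2, generalized Gauss formula. If `Γ ⊂ H` is `μ`-measurable,
`I_Γ ∈ BV(H,H₁)`, `I_Γ` satisfies the ray Hamza condition in every direction `e_k`, and
`(m, σ)` represents `I_Γ` (with `σ` encoded by coordinates `n` in the orthonormal basis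
`(c_j e_j)_j` of `H₁*`), then `m` is carried by the topological boundary `∂Γ`, and
`∫_Γ D*G dμ = ∫_{∂Γ} ⟨G(z), σ(z)⟩ m(dz)` for all `G ∈ (C_b¹)_{D(A)∩H₁}`. -/
theorem generalized_gauss_formula
    {H : Type*} [NormedAddCommGroup H] [InnerProductSpace ℝ H] [CompleteSpace H]
    [SecondCountableTopology H] [MeasurableSpace H] [BorelSpace H]
    (e : ℕ → H) (hON : Orthonormal ℝ e)
    (hTot : (Submodule.span ℝ (Set.range e)).topologicalClosure = ⊤)
    (α : ℕ → ℝ) (δ : ℝ) (hδ : 0 < δ) (hαδ : ∀ j, δ ≤ α j)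
    (hαsum : Summable fun j => (α j)⁻¹)
    (c : ℕ → ℝ) (hc : ∀ j, 1 ≤ c j)
    (μ : Measure H) [IsProbabilityMeasure μ]
    (hGauss : ∀ h : H, μ.map (fun x => ⟪x, h⟫)
      = ProbabilityTheory.gaussianReal 0 (Real.toNNReal ⟪Qop e α h, h⟫))
    (Γ : Set H) (hΓ : MeasurableSet Γ)
    (hBV : BddAbove (BVset c e α μ (Set.indicator Γ fun _ => (1:ℝ))))
    (hHamza : ∀ k : ℕ, RayHamza μ (Set.indicator Γ fun _ => (1:ℝ)) (e k))
    (m : Measure H) [IsFiniteMeasure m]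
    (n : H → ℕ → ℝ) (hn : ∀ j, Measurable fun z => n z j)
    (hunit : ∀ᵐ z ∂m, (∑' j, n z j ^ 2) = 1)
    (hrep : ∀ (k : ℕ) (g : Fin k → H → ℝ) (Dg : Fin k → H → H) (l : Fin k → H),
      (∀ i, IsCb1 (g i) (Dg i)) → (∀ i, memDA e α (l i)) → (∀ i, memH1 c e (l i)) →
      ∫ z in Γ, Dstar e α g Dg l z ∂μ
        = ∫ z, (∑' j, c j * ⟪∑ i, g i z • l i, e j⟫ * n z j) ∂m) :
    m (frontier Γ)ᶜ = 0 ∧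
    ∀ (k : ℕ) (g : Fin k → H → ℝ) (Dg : Fin k → H → H) (l : Fin k → H),
      (∀ i, IsCb1 (g i) (Dg i)) → (∀ i, memDA e α (l i)) → (∀ i, memH1 c e (l i)) →
      ∫ z in Γ, Dstar e α g Dg l z ∂μ
        = ∫ z in frontier Γ, (∑' j, c j * ⟪∑ i, g i z • l i, e j⟫ * n z j) ∂m := by
  have hα : ∀ j, 0 < α j := fun j => hδ.trans_le (hαδ j)
  have hsummable : ∀ z, (∑' j, n z j ^ 2) = 1 → Summable fun j => n z j ^ 2 := fun z hz => by
    by_contra hns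
    rw [tsum_eq_zero_of_not_summable hns] at hz
    exact zero_ne_one hz
  have hint : ∀ k, Integrable (fun z => n z k) m := fun k => by
    refine Integrable.of_bound (hn k).aestronglyMeasurable 1 ?_
    filter_upwards [hunit] with z hz
    have h1 : n z k ^ 2 ≤ 1 := hz ▸ (hsummable z hz).le_tsum k fun j _ => sq_nonneg _
    rwa [Real.norm_eq_abs, ← sq_le_one_iff_abs_le_one]
  have hrep1 : ∀ (k : ℕ) (g : H → ℝ) (Dg : H → H), IsCb1 g Dg →
      ∫ z in Γ, (-⟪e k, Dg z⟫ + 2 * g z * (α k * ⟪e k, z⟫)) ∂μ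
        = c k * ∫ z, g z * n z k ∂m := by
    intro k g Dg hg
    have h := hrep 1 (fun _ => g) (fun _ => Dg) (fun _ => e k) (fun _ => hg)
      (fun _ => summable_sq_mul_inner_basis hON α k) (fun _ => summable_sq_mul_inner_basis hON c k)
    simp only [Dstar, Finset.univ_unique, Finset.sum_singleton, Aop_basis hON,
      real_inner_smul_left] at h
    rw [h, ← integral_const_mul]
    refine integral_congr_ae (ae_of_all _ fun z => ?_)
    simp only
    rw [tsum_eq_single k]
    · rw [real_inner_self_eq_norm_sq, hON.norm_eq_one]
      ring
    · intro j hj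
      rw [hON.inner_eq_zero hj.symm]
      ring
  have hnull : ∀ s ∈ positivitySets H, s ⊆ Γ ∨ s ⊆ Γᶜ → m s = 0 := by
    intro s hs hsΓ
    have hzero : ∀ k, (fun z => n z k) =ᵐ[m.restrict s] 0 := fun k => by
      refine ae_restrict_eq_zero_of_integral_mul_eq_zero (hint k) hs fun v Dv hv hv0 hvs => ?_
      have hF : ∀ z ∉ s, -⟪e k, Dv z⟫ + 2 * v z * (α k * ⟪e k, z⟫) = 0 := fun z hz => by
        simp [hvs z hz, hv.gradient_eq_zero hv0 (hvs z hz)]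
      have hleft : ∫ z in Γ, (-⟪e k, Dv z⟫ + 2 * v z * (α k * ⟪e k, z⟫)) ∂μ = 0 := by
        rcases hsΓ with hsΓ | hsΓ
        · rw [setIntegral_eq_integral_of_forall_compl_eq_zero
            fun z hz => hF z fun h => hz (hsΓ h)]
          exact hv.integral_by_parts hON hα hαsum hGauss k
        · exact setIntegral_eq_zero_of_forall_eq_zero fun z hz => hF z fun h => hsΓ h hz
      rw [hrep1 k v Dv hv] at hleft
      exact (mul_eq_zero.1 hleft).resolve_left (zero_lt_one.trans_le (hc k)).ne'
    have hfalse : ∀ᵐ z ∂m.restrict s, False := by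
      filter_upwards [ae_all_iff.2 hzero, ae_restrict_of_ae hunit] with z hz hz1
      simp only [Pi.zero_apply] at hz
      simp [hz] at hz1
    rwa [Filter.eventually_false_iff_eq_bot, ae_eq_bot, Measure.restrict_eq_zero] at hfalse
  have hm : m (frontier Γ)ᶜ = 0 := by
    refine measure_null_of_locally_null _ fun x hx => ?_
    rw [compl_frontier_eq_union_interior] at hx
    have hloc : ∀ U : Set H, x ∈ interior U → U ⊆ Γ ∨ U ⊆ Γᶜ →
        ∃ u ∈ nhdsWithin x (frontier Γ)ᶜ, m u = 0 := fun U hxU hU => by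
      obtain ⟨s, hs, hxs, hsU⟩ := isTopologicalBasis_positivitySets.exists_subset_of_mem_open
        hxU isOpen_interior
      have hsU' := hsU.trans interior_subset
      exact ⟨s, mem_nhdsWithin_of_mem_nhds ((isOpen_of_mem_positivitySets hs).mem_nhds hxs),
        hnull s hs (hU.imp hsU'.trans hsU'.trans)⟩
    exact hx.elim (fun hx => hloc Γ hx (Or.inl subset_rfl))
      fun hx => hloc Γᶜ hx (Or.inr subset_rfl)
  refine ⟨hm, fun k g Dg l hg hl hl1 => ?_⟩
  rw [hrep k g Dg l hg hl hl1, Measure.restrict_eq_self_of_ae_mem]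
  exact hm
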